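/- Let ν : Ω → ℝ, let f₀ : Ω → ℝ be a nonvanishing twice continuously differentiable solution of Δ f₀ = ν f₀ on Ω, and let v : Ω → ℝ be a twice continuously differentiable solution of (Δ + ν − 2·|∇f₀|²/f₀²) v = 0 on Ω. Suppose θ : Ω → ℝ is twice continuously differentiable with ∂_z̄ θ = i·f₀^{−2}·∂_z̄(f₀·v) on Ω, and set u = −f₀·θ. Then u is a solution of Δ u = ν u on Ω, and W = u + i·v is a solution of the main Vekua equation ∂_z̄ W = (∂_z̄ f₀ / f₀)·conj(W) on Ω. -/

import Mathlib

open Complex ComplexConjugate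

/-- Partial derivative in the `x` direction of a complex-valued function on `ℂ ≃ ℝ²`. -/
noncomputable def pdxC (f : ℂ → ℂ) (z : ℂ) : ℂ := fderiv ℝ f z 1

/-- Partial derivative in the `y` direction of a complex-valued function on `ℂ ≃ ℝ²`. -/
noncomputable def pdyC (f : ℂ → ℂ) (z : ℂ) : ℂ := fderiv ℝ f z Complex.I

/-- `∂_z f = ∂f/∂x − i ∂f/∂y` (without the factor 1/2). -/
noncomputable def dzC (f : ℂ → ℂ) (z : ℂ) : ℂ := pdxC f z - Complex.I * pdyC f z

/-- `∂_z̄ f = ∂f/∂x + i ∂f/∂y` (without the factor 1/2). -/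
noncomputable def dzbarC (f : ℂ → ℂ) (z : ℂ) : ℂ := pdxC f z + Complex.I * pdyC f z

/-- Partial derivative in the `x` direction of a real-valued function on `ℂ ≃ ℝ²`. -/
noncomputable def pdxR (f : ℂ → ℝ) (z : ℂ) : ℝ := fderiv ℝ f z 1

/-- Partial derivative in the `y` direction of a real-valued function on `ℂ ≃ ℝ²`. -/
noncomputable def pdyR (f : ℂ → ℝ) (z : ℂ) : ℝ := fderiv ℝ f z Complex.I

/-- `∂_z f` for a real-valued `f`. -/
noncomputable def dzR (f : ℂ → ℝ) (z : ℂ) : ℂ := (pdxR f z : ℂ) - Complex.I * (pdyR f z : ℂ)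

/-- `∂_z̄ f` for a real-valued `f`. -/
noncomputable def dzbarR (f : ℂ → ℝ) (z : ℂ) : ℂ := (pdxR f z : ℂ) + Complex.I * (pdyR f z : ℂ)

/-- The Laplacian `Δ f = ∂²f/∂x² + ∂²f/∂y²` of a real-valued function on `ℂ ≃ ℝ²`. -/
noncomputable def lapR (f : ℂ → ℝ) (z : ℂ) : ℝ := pdxR (pdxR f) z + pdyR (pdyR f) z

/-- `|∇f|² = (∂_x f)² + (∂_y f)²` for a real-valued function on `ℂ ≃ ℝ²`. -/
noncomputable def gradNormSq (f : ℂ → ℝ) (z : ℂ) : ℝ := (pdxR f z) ^ 2 + (pdyR f z) ^ 2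

lemma aux_mul {f g : ℂ → ℝ} {z : ℂ} (hf : DifferentiableAt ℝ f z) (hg : DifferentiableAt ℝ g z)
    (a : ℂ) : fderiv ℝ (fun w => f w * g w) z a
      = f z * fderiv ℝ g z a + fderiv ℝ f z a * g z := by
  rw [fderiv_fun_mul hf hg]
  simp [mul_comm]

lemma aux_fd {f : ℂ → ℝ} {z : ℂ} (hf : ContDiffAt ℝ 2 f z) :
    DifferentiableAt ℝ (fderiv ℝ f) z :=
  (hf.fderiv_right (m := 1) (by norm_num)).differentiableAt (by norm_num)

lemma aux_d {f : ℂ → ℝ} {z : ℂ} (hf : ContDiffAt ℝ 2 f z) (a : ℂ) :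
    DifferentiableAt ℝ (fun w => fderiv ℝ f w a) z :=
  (aux_fd hf).clm_apply (differentiableAt_const a)

lemma aux_snd {f : ℂ → ℝ} {z : ℂ} (hf : ContDiffAt ℝ 2 f z) (a b : ℂ) :
    fderiv ℝ (fun w => fderiv ℝ f w a) z b = fderiv ℝ (fderiv ℝ f) z b a := by
  rw [fderiv_clm_apply (aux_fd hf) (differentiableAt_const a)]
  simp

lemma aux_symm {f : ℂ → ℝ} {z : ℂ} (hf : ContDiffAt ℝ 2 f z) (a b : ℂ) :
    fderiv ℝ (fun w => fderiv ℝ f w a) z b = fderiv ℝ (fun w => fderiv ℝ f w b) z a := by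
  rw [aux_snd hf, aux_snd hf]
  exact (hf.isSymmSndFDerivAt (by simp)) b a

lemma aux_snd_mul {f g : ℂ → ℝ} {z : ℂ} (hf : ContDiffAt ℝ 2 f z) (hg : ContDiffAt ℝ 2 g z)
    (a : ℂ) : fderiv ℝ (fun w => fderiv ℝ (fun w => f w * g w) w a) z a
      = f z * fderiv ℝ (fun w => fderiv ℝ g w a) z a
        + 2 * (fderiv ℝ f z a * fderiv ℝ g z a)
        + fderiv ℝ (fun w => fderiv ℝ f w a) z a * g z := by
  have h : (fun w => fderiv ℝ (fun w => f w * g w) w a) =ᶠ[nhds z]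
      fun w => f w * fderiv ℝ g w a + fderiv ℝ f w a * g w := by
    filter_upwards [hf.eventually (by simp), hg.eventually (by simp)] with w h1 h2
    exact aux_mul (h1.differentiableAt (by norm_num)) (h2.differentiableAt (by norm_num)) a
  have df := hf.differentiableAt (by norm_num)
  have dg := hg.differentiableAt (by norm_num)
  rw [h.fderiv_eq, fderiv_fun_add (df.fun_mul (aux_d hg a)) ((aux_d hf a).fun_mul dg)]
  rw [_root_.add_apply, aux_mul df (aux_d hg a), aux_mul (aux_d hf a) dg]
  ring

/-- two-dimensional Darboux transformation, inverse direction: given a solution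
`v` of `(Δ + ν − 2|∇f₀|²/f₀²)v = 0`, a real `θ` with `∂_z̄ θ = i f₀⁻² ∂_z̄(f₀ v)`, and
`u = −f₀ θ`, the function `u` solves `Δu = νu` and `W = u + iv` solves the main Vekua
equation. -/
theorem darboux_transformation_inverse
    (Ω : Set ℂ) (hΩ : IsOpen Ω) (ν f₀ v θ : ℂ → ℝ)
    (hf₀C2 : ContDiffOn ℝ 2 f₀ Ω)
    (hf₀ne : ∀ z ∈ Ω, f₀ z ≠ 0)
    (hf₀sol : ∀ z ∈ Ω, lapR f₀ z = ν z * f₀ z)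
    (hvC2 : ContDiffOn ℝ 2 v Ω)
    (hvsol : ∀ z ∈ Ω, lapR v z + ν z * v z - 2 * gradNormSq f₀ z / (f₀ z) ^ 2 * v z = 0)
    (hθC2 : ContDiffOn ℝ 2 θ Ω)
    (hθ : ∀ z ∈ Ω, dzbarR θ z = Complex.I * ((f₀ z : ℂ)) ^ (-2 : ℤ) * dzbarR (fun w => f₀ w * v w) z)
    (u : ℂ → ℝ) (hu : ∀ z, u z = -(f₀ z * θ z))
    (W : ℂ → ℂ) (hW : ∀ z, W z = (u z : ℂ) + Complex.I * (v z : ℂ)) :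
    (∀ z ∈ Ω, lapR u z = ν z * u z) ∧
    (∀ z ∈ Ω, dzbarC W z = dzbarR f₀ z / (f₀ z : ℂ) * conj (W z)) := by
  have cf : ∀ z ∈ Ω, ContDiffAt ℝ 2 f₀ z := fun z hz => hf₀C2.contDiffAt (hΩ.mem_nhds hz)
  have cv : ∀ z ∈ Ω, ContDiffAt ℝ 2 v z := fun z hz => hvC2.contDiffAt (hΩ.mem_nhds hz)
  have ct : ∀ z ∈ Ω, ContDiffAt ℝ 2 θ z := fun z hz => hθC2.contDiffAt (hΩ.mem_nhds hz)
  have df : ∀ z ∈ Ω, DifferentiableAt ℝ f₀ z := fun z hz => (cf z hz).differentiableAt (by norm_num)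
  have dv : ∀ z ∈ Ω, DifferentiableAt ℝ v z := fun z hz => (cv z hz).differentiableAt (by norm_num)
  have dt : ∀ z ∈ Ω, DifferentiableAt ℝ θ z := fun z hz => (ct z hz).differentiableAt (by norm_num)
  have hue : u = fun z => -(f₀ z * θ z) := funext hu
  have key : ∀ z ∈ Ω, (f₀ z * f₀ z) * fderiv ℝ θ z 1 = -fderiv ℝ (fun w => f₀ w * v w) z I ∧
      (f₀ z * f₀ z) * fderiv ℝ θ z I = fderiv ℝ (fun w => f₀ w * v w) z 1 := by
    intro z hz
    have h := hθ z hz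
    have hne : (f₀ z : ℂ) ≠ 0 := by exact_mod_cast hf₀ne z hz
    have h2 : ((f₀ z * f₀ z : ℝ) : ℂ) * dzbarR θ z = I * dzbarR (fun w => f₀ w * v w) z := by
      rw [h, zpow_neg]
      push_cast
      field_simp
    simp only [dzbarR, pdxR, pdyR] at h2
    have hr := congrArg Complex.re h2
    have hi := congrArg Complex.im h2
    simp [-ofReal_mul] at hr hi
    exact ⟨hr, hi⟩
  have hux : ∀ z ∈ Ω, ∀ a, fderiv ℝ u z a = -(f₀ z * fderiv ℝ θ z a + fderiv ℝ f₀ z a * θ z) := by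
    intro z hz a
    rw [hue, fderiv_fun_neg, _root_.neg_apply, aux_mul (df z hz) (dt z hz)]
  refine ⟨fun z hz => ?_, fun z hz => ?_⟩
  · have cg : ContDiffAt ℝ 2 (fun w => f₀ w * v w) z := (cf z hz).mul (cv z hz)
    have k1 : (fun w => (f₀ w * f₀ w) * fderiv ℝ θ w 1) =ᶠ[nhds z]
        fun w => -fderiv ℝ (fun w => f₀ w * v w) w I := by
      filter_upwards [hΩ.mem_nhds hz] with w hw using (key w hw).1
    have k2 : (fun w => (f₀ w * f₀ w) * fderiv ℝ θ w I) =ᶠ[nhds z]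
        fun w => fderiv ℝ (fun w => f₀ w * v w) w 1 := by
      filter_upwards [hΩ.mem_nhds hz] with w hw using (key w hw).2
    have e1 := congrArg (fun L : ℂ →L[ℝ] ℝ => L 1) k1.fderiv_eq
    have e2 := congrArg (fun L : ℂ →L[ℝ] ℝ => L I) k2.fderiv_eq
    have dff := (df z hz).fun_mul (df z hz)
    rw [aux_mul dff (aux_d (ct z hz) 1), aux_mul (df z hz) (df z hz), fderiv_fun_neg,
      _root_.neg_apply, aux_symm cg] at e1
    rw [aux_mul dff (aux_d (ct z hz) I), aux_mul (df z hz) (df z hz)] at e2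
    have hl : ∀ a, fderiv ℝ (fun w => fderiv ℝ u w a) z a
        = -fderiv ℝ (fun w => fderiv ℝ (fun w => f₀ w * θ w) w a) z a := by
      intro a
      have : (fun w => fderiv ℝ u w a) = fun w => -fderiv ℝ (fun w => f₀ w * θ w) w a := by
        funext w
        rw [hue, fderiv_fun_neg, _root_.neg_apply]
      rw [this, fderiv_fun_neg, _root_.neg_apply]
    have hs : fderiv ℝ (fun w => fderiv ℝ f₀ w 1) z 1 + fderiv ℝ (fun w => fderiv ℝ f₀ w I) z I
        = ν z * f₀ z := hf₀sol z hz
    change fderiv ℝ (fun w => fderiv ℝ u w 1) z 1 + fderiv ℝ (fun w => fderiv ℝ u w I) z I = _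
    rw [hl, hl, aux_snd_mul (cf z hz) (ct z hz), aux_snd_mul (cf z hz) (ct z hz), hu]
    apply mul_left_cancel₀ (hf₀ne z hz)
    linear_combination (-1) * e1 - e2 - f₀ z * θ z * hs
  · have hne := hf₀ne z hz
    have hneC : (f₀ z : ℂ) ≠ 0 := by exact_mod_cast hne
    have du : DifferentiableAt ℝ u z := by
      rw [hue]; exact ((df z hz).fun_mul (dt z hz)).fun_neg
    have hWd : HasFDerivAt W (ofRealCLM.comp (fderiv ℝ u z)
        + I • ofRealCLM.comp (fderiv ℝ v z)) z := by
      have : W = fun z => (u z : ℂ) + I * (v z : ℂ) := funext hW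
      rw [this]
      exact (ofRealCLM.hasFDerivAt.comp z du.hasFDerivAt).add
        ((ofRealCLM.hasFDerivAt.comp z (dv z hz).hasFDerivAt).const_mul I)
    obtain ⟨a1, a2⟩ := key z hz
    rw [aux_mul (df z hz) (dv z hz)] at a1 a2
    simp only [dzbarC, dzbarR, pdxC, pdyC, pdxR, pdyR, hWd.fderiv]
    rw [div_mul_eq_mul_div, eq_div_iff hneC]
    rw [hW]
    apply Complex.ext
    · simp [hux z hz, hu]
      linear_combination -a1
    · simp [hux z hz, hu]
      linear_combination -a2
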